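/- Theorem 1.1 (exponential convergence of policy iteration for the discrete space-time scheme): Assume conditions (N2) and (N4). Let λ^h, Λ^h satisfy ν_h ≤ λ^h and 0 < λ^h ≤ Σ_i(t,x) + ν_h ≤ Λ^h for every i ∈ {1,…,d} and every (t,x). Set C_1 := 48 max{‖c‖²_∞, 2d‖f‖²_∞} and C_h := e^{C_1 T/λ^h} (12‖g‖²_∞ + Tλ^h). Then for every n ≥ 1, sup_{(t,x) ∈ Ω^{τ,h}_T} |V_n^{τ,h}(t,x) − V^{τ,h}(t,x)|² ≤ C_h · 2^{−n−1}. -/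

import Mathlib

open scoped BigOperators

noncomputable section

/-- Forward difference quotient `D_i^h φ(x) = (φ(x+h e_i) - φ(x))/h`. -/
def Dp {d : ℕ} (h : ℝ) (φ : (Fin d → ℝ) → ℝ) (x : Fin d → ℝ) (i : Fin d) : ℝ :=
  (φ (Function.update x i (x i + h)) - φ x) / h

/-- Backward difference quotient `D_{-i}^h φ(x) = (φ(x-h e_i) - φ(x))/h`. -/
def Dm {d : ℕ} (h : ℝ) (φ : (Fin d → ℝ) → ℝ) (x : Fin d → ℝ) (i : Fin d) : ℝ :=
  (φ (Function.update x i (x i - h)) - φ x) / h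

/-- Central difference gradient `∇^h`. -/
def cgrad {d : ℕ} (h : ℝ) (φ : (Fin d → ℝ) → ℝ) (x : Fin d → ℝ) : Fin d → ℝ :=
  fun i => (φ (Function.update x i (x i + h)) - φ (Function.update x i (x i - h))) / (2 * h)

/-- Discrete second difference `Δ_i^h`. -/
def lap1 {d : ℕ} (h : ℝ) (φ : (Fin d → ℝ) → ℝ) (x : Fin d → ℝ) (i : Fin d) : ℝ :=
  (φ (Function.update x i (x i + h)) - 2 * φ x + φ (Function.update x i (x i - h))) / h ^ 2

/-- Backward time difference quotient `∂_t^τ`. -/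
def dtT {d : ℕ} (τ : ℝ) (φ : ℝ → (Fin d → ℝ) → ℝ) (t : ℝ) (x : Fin d → ℝ) : ℝ :=
  (φ t x - φ (t - τ) x) / τ

/-- Euclidean norm of a vector in `Fin d → ℝ`. -/
def nrm {d : ℕ} (v : Fin d → ℝ) : ℝ := Real.sqrt (∑ i, v i ^ 2)

/-- The time grid `ℕ^τ_T = {0, τ, 2τ, …, T}`. -/
def timeGrid (τ T t : ℝ) : Prop := (∃ k : ℕ, t = k * τ) ∧ t ≤ T

/-- The space grid `ℤ^d_h = hℤ^d`. -/
def spaceGrid {d : ℕ} (h : ℝ) (x : Fin d → ℝ) : Prop := ∀ i, ∃ z : ℤ, x i = z * h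

/-- The running cost `L(t,x,p)(a,b) = c(t,x,a,b) + p · f(t,x,a,b)`. -/
def Lrun {d m₁ m₂ : ℕ} (c : ℝ → (Fin d → ℝ) → (Fin m₁ → ℝ) → (Fin m₂ → ℝ) → ℝ)
    (f : ℝ → (Fin d → ℝ) → (Fin m₁ → ℝ) → (Fin m₂ → ℝ) → Fin d → ℝ)
    (t : ℝ) (x p : Fin d → ℝ) (a : Fin m₁ → ℝ) (b : Fin m₂ → ℝ) : ℝ :=
  c t x a b + ∑ i, p i * f t x a b i

/-- The sup-inf (Isaacs) Hamiltonian `H(t,x,p) = max_{b ∈ B} min_{a ∈ A} L(t,x,p)(a,b)`. -/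
def Ham {d m₁ m₂ : ℕ} (A : Set (Fin m₁ → ℝ)) (B : Set (Fin m₂ → ℝ))
    (c : ℝ → (Fin d → ℝ) → (Fin m₁ → ℝ) → (Fin m₂ → ℝ) → ℝ)
    (f : ℝ → (Fin d → ℝ) → (Fin m₁ → ℝ) → (Fin m₂ → ℝ) → Fin d → ℝ)
    (t : ℝ) (x p : Fin d → ℝ) : ℝ :=
  sSup ((fun b => sInf ((fun a => Lrun c f t x p a b) '' A)) '' B)

/-! ### Auxiliary facts -/

/-- The averaging operator of the explicit scheme. -/
def Pop {d : ℕ} (τ h : ℝ) (a : Fin d → ℝ) (φ : (Fin d → ℝ) → ℝ) (x : Fin d → ℝ) : ℝ :=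
  φ x + τ * ((1/2) * ∑ i, a i * lap1 h φ x i)

theorem Pop_add {d : ℕ} (τ h : ℝ) (a : Fin d → ℝ) (φ ψ : (Fin d → ℝ) → ℝ) (x : Fin d → ℝ) :
    Pop τ h a (fun y => φ y + ψ y) x = Pop τ h a φ x + Pop τ h a ψ x := by
  have : ∀ i, a i * lap1 h (fun y => φ y + ψ y) x i
      = a i * lap1 h φ x i + a i * lap1 h ψ x i := by
    intro i; unfold lap1; ring
  unfold Pop
  rw [Finset.sum_congr rfl (fun i _ => this i), Finset.sum_add_distrib]; ring

theorem Pop_smul {d : ℕ} (τ h : ℝ) (a : Fin d → ℝ) (r : ℝ) (φ : (Fin d → ℝ) → ℝ)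
    (x : Fin d → ℝ) :
    Pop τ h a (fun y => r * φ y) x = r * Pop τ h a φ x := by
  have : ∀ i, a i * lap1 h (fun y => r * φ y) x i = r * (a i * lap1 h φ x i) := by
    intro i; unfold lap1; ring
  unfold Pop
  rw [Finset.sum_congr rfl (fun i _ => this i), ← Finset.mul_sum]; ring

/-- The averaging form of `Pop`. -/
theorem Pop_avg {d : ℕ} (τ h : ℝ) (a : Fin d → ℝ) (φ : (Fin d → ℝ) → ℝ) (x : Fin d → ℝ) :
    Pop τ h a φ x = (1 - ∑ i, τ * a i / h ^ 2) * φ x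
      + ∑ i, (τ * a i / h ^ 2) *
        ((φ (Function.update x i (x i + h)) + φ (Function.update x i (x i - h))) / 2) := by
  unfold Pop
  rw [sub_mul, Finset.sum_mul, Finset.mul_sum, Finset.mul_sum, one_mul, sub_add,
    ← Finset.sum_sub_distrib, sub_eq_add_neg, ← Finset.sum_neg_distrib]
  congr 1
  refine Finset.sum_congr rfl (fun i _ => ?_)
  unfold lap1; ring

theorem Pop_le {d : ℕ} {τ h : ℝ} (a : Fin d → ℝ) (φ : (Fin d → ℝ) → ℝ) (x : Fin d → ℝ)
    (ha : ∀ i, 0 ≤ τ * a i / h ^ 2) (hs : ∑ i, τ * a i / h ^ 2 ≤ 1) (M : ℝ)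
    (h0 : φ x ≤ M) (h1 : ∀ i, φ (Function.update x i (x i + h)) ≤ M)
    (h2 : ∀ i, φ (Function.update x i (x i - h)) ≤ M) : Pop τ h a φ x ≤ M := by
  rw [Pop_avg]
  have e1 : (1 - ∑ i, τ * a i / h ^ 2) * φ x ≤ (1 - ∑ i, τ * a i / h ^ 2) * M :=
    mul_le_mul_of_nonneg_left h0 (by linarith)
  have e2 : ∑ i, (τ * a i / h ^ 2) *
        ((φ (Function.update x i (x i + h)) + φ (Function.update x i (x i - h))) / 2)
      ≤ ∑ i, (τ * a i / h ^ 2) * M :=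
    Finset.sum_le_sum (fun i _ => mul_le_mul_of_nonneg_left (by linarith [h1 i, h2 i]) (ha i))
  rw [← Finset.sum_mul] at e2
  linarith

/-- The variance inequality. -/
theorem Pop_sq {d : ℕ} {τ h L : ℝ} (hτ : 0 < τ) (hh : 0 < h) (a : Fin d → ℝ)
    (w : (Fin d → ℝ) → ℝ) (x : Fin d → ℝ)
    (haL : ∀ i, L ≤ a i) (ha : ∀ i, 0 ≤ τ * a i / h ^ 2) (hs : ∑ i, τ * a i / h ^ 2 ≤ 1) :
    Pop τ h a w x ^ 2 + τ * L * ∑ i, cgrad h w x i ^ 2 ≤ Pop τ h a (fun y => w y ^ 2) x := by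
  have key : ∀ (θ m : Fin d → ℝ) (w0 : ℝ), (∀ i, 0 ≤ θ i) → ∑ i, θ i ≤ 1 →
      ((1 - ∑ i, θ i) * w0 + ∑ i, θ i * m i) ^ 2
        ≤ (1 - ∑ i, θ i) * w0 ^ 2 + ∑ i, θ i * m i ^ 2 := by
    intro θ m w0 h0 h1
    set p := (1 - ∑ i, θ i) * w0 + ∑ i, θ i * m i with hp
    have e1 : 0 ≤ ∑ i, θ i * (m i - p) ^ 2 :=
      Finset.sum_nonneg (fun i _ => mul_nonneg (h0 i) (sq_nonneg _))
    have e2 : 0 ≤ (1 - ∑ i, θ i) * (w0 - p) ^ 2 := mul_nonneg (by linarith) (sq_nonneg _)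
    have e3 : ∑ i, θ i * (m i - p) ^ 2
        = ∑ i, θ i * m i ^ 2 - 2 * p * ∑ i, θ i * m i + p ^ 2 * ∑ i, θ i := by
      rw [Finset.mul_sum, Finset.mul_sum, ← Finset.sum_sub_distrib, ← Finset.sum_add_distrib]
      exact Finset.sum_congr rfl (fun i _ => by ring)
    have e4 : ∑ i, θ i * m i = p - (1 - ∑ i, θ i) * w0 := by rw [hp]; ring
    rw [e4] at e3
    nlinarith
  have hk := key (fun i => τ * a i / h ^ 2) (fun i => (w (Function.update x i (x i + h))
      + w (Function.update x i (x i - h))) / 2) (w x) ha hs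
  rw [Pop_avg, Pop_avg]
  have e5 : ∑ i, (τ * a i / h ^ 2) * ((w (Function.update x i (x i + h))
        + w (Function.update x i (x i - h))) / 2) ^ 2 + τ * L * ∑ i, cgrad h w x i ^ 2
      ≤ ∑ i, (τ * a i / h ^ 2) *
        ((w (Function.update x i (x i + h)) ^ 2 + w (Function.update x i (x i - h)) ^ 2) / 2) := by
    rw [Finset.mul_sum, ← Finset.sum_add_distrib]
    refine Finset.sum_le_sum (fun i _ => ?_)
    have e6 : (τ * a i / h ^ 2) *
        ((w (Function.update x i (x i + h)) ^ 2 + w (Function.update x i (x i - h)) ^ 2) / 2)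
        = (τ * a i / h ^ 2) * ((w (Function.update x i (x i + h))
        + w (Function.update x i (x i - h))) / 2) ^ 2 + τ * a i * cgrad h w x i ^ 2 := by
      unfold cgrad
      field_simp
      ring
    rw [e6]
    have := mul_le_mul_of_nonneg_right (mul_le_mul_of_nonneg_left (haL i) hτ.le)
      (sq_nonneg (cgrad h w x i))
    linarith
  linarith

theorem young_aux {s p K r : ℝ} (hK : 0 ≤ K) (hr : 0 ≤ r) (hs : s ^ 2 ≤ K * r) :
    2 * s * p ≤ K * p ^ 2 + r := by
  have h0 : 0 ≤ K * p ^ 2 + r := by positivity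
  refine (le_abs_self _).trans (abs_le_of_sq_le_sq ?_ h0)
  nlinarith [sq_nonneg (K * p ^ 2 - r), mul_le_mul_of_nonneg_right hs (sq_nonneg p)]

/-- One step of the squared scheme. -/
theorem step_sq {d : ℕ} {τ h L K : ℝ} (hτ : 0 < τ) (hh : 0 < h) (hK : 0 ≤ K) (a : Fin d → ℝ)
    (w : (Fin d → ℝ) → ℝ) (x : Fin d → ℝ) (hL : 0 ≤ L)
    (haL : ∀ i, L ≤ a i) (ha : ∀ i, 0 ≤ τ * a i / h ^ 2) (hs : ∑ i, τ * a i / h ^ 2 ≤ 1)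
    {s r v : ℝ} (hr : 0 ≤ r) (hsr : s ^ 2 ≤ K * r) (hv : v = Pop τ h a w x + τ * s) :
    v ^ 2 ≤ (1 + τ * K) * Pop τ h a (fun y => w y ^ 2) x
      - τ * L * ∑ i, cgrad h w x i ^ 2 + τ * (r + τ * s ^ 2) := by
  have h1 := Pop_sq hτ hh a w x haL ha hs
  have h2 := young_aux (p := Pop τ h a w x) hK hr hsr
  have h3 : 0 ≤ τ * L * ∑ i, cgrad h w x i ^ 2 :=
    mul_nonneg (by positivity) (Finset.sum_nonneg (fun i _ => sq_nonneg _))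
  have h4 : τ * (2 * s * Pop τ h a w x) ≤ τ * (K * Pop τ h a w x ^ 2 + r) :=
    mul_le_mul_of_nonneg_left h2 hτ.le
  have h5 : τ * K * Pop τ h a w x ^ 2 ≤ τ * K * Pop τ h a (fun y => w y ^ 2) x :=
    mul_le_mul_of_nonneg_left (by linarith) (by positivity)
  rw [hv]
  nlinarith

theorem dot_sq_le {d : ℕ} (p v : Fin d → ℝ) {M : ℝ} (hv : nrm v ≤ M) :
    (∑ i, p i * v i) ^ 2 ≤ M ^ 2 * ∑ i, p i ^ 2 := by
  have h1 := Finset.sum_mul_sq_le_sq_mul_sq Finset.univ p v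
  have h0 : 0 ≤ nrm v := Real.sqrt_nonneg _
  have h2 : ∑ i, v i ^ 2 = nrm v ^ 2 :=
    (Real.sq_sqrt (Finset.sum_nonneg (fun i _ => sq_nonneg _))).symm
  have h3 : nrm v ^ 2 ≤ M ^ 2 := by gcongr
  rw [h2] at h1
  have h4 : 0 ≤ ∑ i, p i ^ 2 := Finset.sum_nonneg (fun i _ => sq_nonneg _)
  nlinarith

theorem dot_abs_le {d : ℕ} (p v : Fin d → ℝ) {M : ℝ} (hv : nrm v ≤ M) :
    |∑ i, p i * v i| ≤ M * nrm p := by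
  have hM : 0 ≤ M := (Real.sqrt_nonneg _).trans hv
  have h0 : 0 ≤ nrm p := Real.sqrt_nonneg _
  refine abs_le_of_sq_le_sq ?_ (by positivity)
  rw [mul_pow, nrm, Real.sq_sqrt (Finset.sum_nonneg (fun i _ => sq_nonneg _))]
  exact dot_sq_le p v hv

theorem Lrun_sub {d m₁ m₂ : ℕ}
    {c : ℝ → (Fin d → ℝ) → (Fin m₁ → ℝ) → (Fin m₂ → ℝ) → ℝ}
    {f : ℝ → (Fin d → ℝ) → (Fin m₁ → ℝ) → (Fin m₂ → ℝ) → Fin d → ℝ}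
    (t : ℝ) (x p p' : Fin d → ℝ) (a : Fin m₁ → ℝ) (b : Fin m₂ → ℝ) :
    Lrun c f t x p a b - Lrun c f t x p' a b = ∑ i, (p i - p' i) * f t x a b i := by
  unfold Lrun
  rw [add_sub_add_left_eq_sub, ← Finset.sum_sub_distrib]
  exact Finset.sum_congr rfl (fun i _ => by ring)

theorem Lrun_abs {d m₁ m₂ : ℕ}
    {c : ℝ → (Fin d → ℝ) → (Fin m₁ → ℝ) → (Fin m₂ → ℝ) → ℝ}
    {f : ℝ → (Fin d → ℝ) → (Fin m₁ → ℝ) → (Fin m₂ → ℝ) → Fin d → ℝ}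
    {Mc Mf : ℝ}
    (hMc : ∀ t x a b, |c t x a b| ≤ Mc)
    (hMf : ∀ t x a b, nrm (f t x a b) ≤ Mf)
    (t : ℝ) (x p : Fin d → ℝ) (a : Fin m₁ → ℝ) (b : Fin m₂ → ℝ) :
    |Lrun c f t x p a b| ≤ Mc + Mf * nrm p :=
  (abs_add_le _ _).trans (add_le_add (hMc t x a b) (dot_abs_le p _ (hMf t x a b)))

/-- abstract sup-inf -/
def supinf {X Y : Type*} (A : Set X) (B : Set Y) (φ : X → Y → ℝ) : ℝ :=
  sSup ((fun b => sInf ((fun a => φ a b) '' A)) '' B)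

theorem inf_le_aux {X Y : Type*} {A : Set X} {φ : X → Y → ℝ}
    {M : ℝ} (hM : ∀ a b, |φ a b| ≤ M) (b : Y) {a : X} (ha : a ∈ A) :
    sInf ((fun a => φ a b) '' A) ≤ φ a b := by
  refine csInf_le ⟨-M, ?_⟩ ⟨a, ha, rfl⟩
  rintro _ ⟨a', _, rfl⟩
  exact (abs_le.1 (hM a' b)).1

theorem le_supinf_aux {X Y : Type*} {A : Set X} {B : Set Y} (hA : A.Nonempty) {φ : X → Y → ℝ}
    {M : ℝ} (hM : ∀ a b, |φ a b| ≤ M) {b : Y} (hb : b ∈ B) :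
    sInf ((fun a => φ a b) '' A) ≤ supinf A B φ := by
  refine le_csSup ⟨M, ?_⟩ ⟨b, hb, rfl⟩
  rintro _ ⟨b', _, rfl⟩
  obtain ⟨a, ha⟩ := hA
  exact (inf_le_aux hM b' ha).trans (abs_le.1 (hM a b')).2

theorem supinf_le_add {X Y : Type*} {A : Set X} {B : Set Y} (hA : A.Nonempty) (hB : B.Nonempty)
    {φ ψ : X → Y → ℝ} {M M' ε : ℝ} (hM : ∀ a b, |φ a b| ≤ M) (hM' : ∀ a b, |ψ a b| ≤ M')
    (hle : ∀ a b, φ a b ≤ ψ a b + ε) : supinf A B φ ≤ supinf A B ψ + ε := by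
  refine csSup_le (hB.image _) ?_
  rintro _ ⟨b, hb, rfl⟩
  refine le_trans ?_ (add_le_add_left (le_supinf_aux hA hM' hb) ε)
  rw [← sub_le_iff_le_add]
  refine le_csInf (hA.image _) ?_
  rintro _ ⟨a, ha, rfl⟩
  have := inf_le_aux hM b ha
  have := hle a b
  simp only
  linarith

theorem supinf_abs {X Y : Type*} {A : Set X} {B : Set Y} (hA : A.Nonempty) (hB : B.Nonempty)
    {φ : X → Y → ℝ} {M : ℝ} (hM : ∀ a b, |φ a b| ≤ M) : |supinf A B φ| ≤ M := by
  rw [abs_le]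
  constructor
  · obtain ⟨b, hb⟩ := hB
    refine le_trans ?_ (le_supinf_aux hA hM hb)
    refine le_csInf (hA.image _) ?_
    rintro _ ⟨a, ha, rfl⟩
    exact (abs_le.1 (hM a b)).1
  · refine csSup_le (hB.image _) ?_
    rintro _ ⟨b, hb, rfl⟩
    obtain ⟨a, ha⟩ := hA
    exact (inf_le_aux hM b ha).trans (abs_le.1 (hM a b)).2

theorem supinf_eq {X Y : Type*} {A : Set X} {B : Set Y} (hA : A.Nonempty) (hB : B.Nonempty)
    {φ : X → Y → ℝ} {M : ℝ} (hM : ∀ a b, |φ a b| ≤ M) (α : Y → X) (β : Y)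
    (hα : ∀ b, α b ∈ A) (hβ : β ∈ B) (hmin : ∀ b ∈ B, ∀ a ∈ A, φ (α b) b ≤ φ a b)
    (hmax : ∀ b ∈ B, φ (α b) b ≤ φ (α β) β) : supinf A B φ = φ (α β) β := by
  refine le_antisymm ?_ ?_
  · refine csSup_le (hB.image _) ?_
    rintro _ ⟨b, hb, rfl⟩
    exact (inf_le_aux hM b (hα b)).trans (hmax b hb)
  · refine le_trans ?_ (le_supinf_aux hA hM hβ)
    refine le_csInf (hA.image _) ?_
    rintro _ ⟨a, ha, rfl⟩
    exact hmin β hβ a ha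

theorem Ham_sub_abs {d m₁ m₂ : ℕ} {A : Set (Fin m₁ → ℝ)} {B : Set (Fin m₂ → ℝ)}
    (hA : A.Nonempty) (hB : B.Nonempty)
    {c : ℝ → (Fin d → ℝ) → (Fin m₁ → ℝ) → (Fin m₂ → ℝ) → ℝ}
    {f : ℝ → (Fin d → ℝ) → (Fin m₁ → ℝ) → (Fin m₂ → ℝ) → Fin d → ℝ}
    {Mc Mf : ℝ}
    (hMc : ∀ t x a b, |c t x a b| ≤ Mc)
    (hMf : ∀ t x a b, nrm (f t x a b) ≤ Mf)
    (t : ℝ) (x p p' : Fin d → ℝ) :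
    |Ham A B c f t x p - Ham A B c f t x p'| ≤ Mf * nrm (fun i => p i - p' i) := by
  have key : ∀ a b, |Lrun c f t x p a b - Lrun c f t x p' a b| ≤ Mf * nrm (fun i => p i - p' i) := by
    intro a b
    rw [Lrun_sub]
    exact dot_abs_le (fun i => p i - p' i) _ (hMf t x a b)
  rw [abs_sub_le_iff]
  constructor
  · have := supinf_le_add (φ := Lrun c f t x p) (ψ := Lrun c f t x p') hA hB (ε := Mf * nrm (fun i => p i - p' i))
      (Lrun_abs hMc hMf t x p) (Lrun_abs hMc hMf t x p')
      (fun a b => by have := (abs_le.1 (key a b)).2; linarith)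
    have h2 : Ham A B c f t x p ≤ Ham A B c f t x p' + _ := this
    linarith
  · have := supinf_le_add (φ := Lrun c f t x p') (ψ := Lrun c f t x p) hA hB (ε := Mf * nrm (fun i => p i - p' i))
      (Lrun_abs hMc hMf t x p') (Lrun_abs hMc hMf t x p)
      (fun a b => by have := (abs_le.1 (key a b)).1; linarith)
    have h2 : Ham A B c f t x p' ≤ Ham A B c f t x p + _ := this
    linarith

theorem nrm_sq {d : ℕ} (v : Fin d → ℝ) : nrm v ^ 2 = ∑ i, v i ^ 2 :=
  Real.sq_sqrt (Finset.sum_nonneg (fun i _ => sq_nonneg _))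

theorem sum_sub_sq {d : ℕ} (p q : Fin d → ℝ) :
    ∑ i, (p i - q i) ^ 2 ≤ 2 * ∑ i, p i ^ 2 + 2 * ∑ i, q i ^ 2 := by
  rw [Finset.mul_sum, Finset.mul_sum, ← Finset.sum_add_distrib]
  exact Finset.sum_le_sum (fun i _ => by nlinarith [sq_nonneg (p i + q i)])

/-- Step estimate for a source with linear growth in the gradient. -/
theorem step_base {d : ℕ} {τ h lam m : ℝ} (hτ : 0 < τ) (hh : 0 < h) (hm : 0 ≤ m)
    (hlam : 0 < lam) (a : Fin d → ℝ)
    (w : (Fin d → ℝ) → ℝ) (x : Fin d → ℝ)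
    (haL : ∀ i, max lam (96 * τ * m) ≤ a i) (ha : ∀ i, 0 ≤ τ * a i / h ^ 2)
    (hs : ∑ i, τ * a i / h ^ 2 ≤ 1)
    {s v : ℝ} (hsr : s ^ 2 ≤ m * (2 + ∑ i, cgrad h w x i ^ 2))
    (hv : v = Pop τ h a w x + τ * s) :
    v ^ 2 ≤ (1 + τ * (48 * m / lam)) * Pop τ h a (fun y => w y ^ 2) x
      - τ * max lam (96 * τ * m) * (1/2) * ∑ i, cgrad h w x i ^ 2
      + τ * lam / 24 * (1 + τ * (48 * m / lam)) := by
  have hq : 0 ≤ ∑ i, cgrad h w x i ^ 2 := Finset.sum_nonneg (fun i _ => sq_nonneg _)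
  set q := ∑ i, cgrad h w x i ^ 2 with hqdef
  have hL1 : lam ≤ max lam (96 * τ * m) := le_max_left _ _
  have hL2 : 96 * τ * m ≤ max lam (96 * τ * m) := le_max_right _ _
  have h1 := step_sq (L := max lam (96 * τ * m)) (K := 48 * m / lam) hτ hh (by positivity) a w x
    (hlam.le.trans hL1) haL ha hs (s := s) (r := lam * (2 + q) / 48) (by positivity)
    (by
      have : 48 * m / lam * (lam * (2 + q) / 48) = m * (2 + q) := by field_simp
      rw [this]; exact hsr) hv
  rw [← hqdef] at h1
  set L := max lam (96 * τ * m)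
  have h2 : τ * s ^ 2 ≤ τ * (m * (2 + q)) := mul_le_mul_of_nonneg_left hsr hτ.le
  have h3 : lam * q ≤ L * q := mul_le_mul_of_nonneg_right hL1 hq
  have h4 : 96 * τ * m * q ≤ L * q := mul_le_mul_of_nonneg_right hL2 hq
  have hLq : 0 ≤ L * q := mul_nonneg (hlam.le.trans hL1) hq
  have h5 : lam * (2 + q) / 48 + τ * s ^ 2 ≤ lam / 24 + 2 * τ * m + L * q * (1/2) := by linarith
  have h6 := mul_le_mul_of_nonneg_left h5 hτ.le
  have h7 : τ * lam / 24 * (1 + τ * (48 * m / lam)) = τ * (lam / 24 + 2 * τ * m) := by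
    field_simp; ring
  rw [h7]
  linarith

/-- Step estimate for the difference. -/
theorem step_diff {d : ℕ} {τ h lam m : ℝ} (hτ : 0 < τ) (hh : 0 < h) (hm : 0 ≤ m)
    (hlam : 0 < lam) (a : Fin d → ℝ)
    (w : (Fin d → ℝ) → ℝ) (x : Fin d → ℝ)
    (haL : ∀ i, max lam (96 * τ * m) ≤ a i) (ha : ∀ i, 0 ≤ τ * a i / h ^ 2)
    (hs : ∑ i, τ * a i / h ^ 2 ≤ 1)
    {s v q' : ℝ} (hq' : 0 ≤ q') (hsr : s ^ 2 ≤ 3 * m * (∑ i, cgrad h w x i ^ 2 + q'))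
    (hv : v = Pop τ h a w x + τ * s) :
    v ^ 2 ≤ (1 + τ * (48 * m / lam)) * Pop τ h a (fun y => w y ^ 2) x
      - τ * max lam (96 * τ * m) * (1/4) * ∑ i, cgrad h w x i ^ 2
      + τ * max lam (96 * τ * m) * (1/8) * q' := by
  have hq : 0 ≤ ∑ i, cgrad h w x i ^ 2 := Finset.sum_nonneg (fun i _ => sq_nonneg _)
  set q := ∑ i, cgrad h w x i ^ 2 with hqdef
  have hL1 : lam ≤ max lam (96 * τ * m) := le_max_left _ _
  have hL2 : 96 * τ * m ≤ max lam (96 * τ * m) := le_max_right _ _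
  have h1 := step_sq (L := max lam (96 * τ * m)) (K := 48 * m / lam) hτ hh (by positivity) a w x
    (hlam.le.trans hL1) haL ha hs (s := s) (r := lam * (q + q') / 16) (by positivity)
    (by
      have : 48 * m / lam * (lam * (q + q') / 16) = 3 * m * (q + q') := by field_simp; ring
      rw [this]; exact hsr) hv
  rw [← hqdef] at h1
  set L := max lam (96 * τ * m)
  have hqq : 0 ≤ q + q' := by positivity
  have h2 : τ * s ^ 2 ≤ τ * (3 * m * (q + q')) := mul_le_mul_of_nonneg_left hsr hτ.le
  have h3 : lam * (q + q') ≤ L * (q + q') := mul_le_mul_of_nonneg_right hL1 hqq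
  have h4 : 96 * τ * m * (q + q') ≤ L * (q + q') := mul_le_mul_of_nonneg_right hL2 hqq
  have hLq : 0 ≤ L * (q + q') := mul_nonneg (hlam.le.trans hL1) hqq
  have hLq0 : 0 ≤ L * q := mul_nonneg (hlam.le.trans hL1) hq
  have h5 : lam * (q + q') / 16 + τ * s ^ 2 ≤ L * (q + q') * (1/8) := by linarith
  have h6 := mul_le_mul_of_nonneg_left h5 hτ.le
  have h7 : 0 ≤ τ * (L * q) := mul_nonneg hτ.le hLq0
  linarith

theorem Pop_sub {d : ℕ} (τ h : ℝ) (a : Fin d → ℝ) (φ ψ : (Fin d → ℝ) → ℝ) (x : Fin d → ℝ) :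
    Pop τ h a (fun y => φ y - ψ y) x = Pop τ h a φ x - Pop τ h a ψ x := by
  have h1 := Pop_add τ h a φ (fun y => (-1) * ψ y) x
  rw [Pop_smul] at h1
  have h2 : (fun y => φ y - ψ y) = fun y => φ y + (-1) * ψ y := by funext y; ring
  rw [h2, h1]; ring

theorem cgrad_sub {d : ℕ} (h : ℝ) (φ ψ : (Fin d → ℝ) → ℝ) (x : Fin d → ℝ) (i : Fin d) :
    cgrad h (fun y => φ y - ψ y) x i = cgrad h φ x i - cgrad h ψ x i := by
  unfold cgrad; ring

theorem spaceGrid_add {d : ℕ} {h : ℝ} {x : Fin d → ℝ} (hx : spaceGrid h x) (i : Fin d) :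
    spaceGrid h (Function.update x i (x i + h)) := by
  intro j
  by_cases hj : j = i
  · subst hj
    obtain ⟨z, hz⟩ := hx j
    exact ⟨z + 1, by rw [Function.update_self, hz]; push_cast; ring⟩
  · rw [Function.update_of_ne hj]; exact hx j

theorem spaceGrid_sub {d : ℕ} {h : ℝ} {x : Fin d → ℝ} (hx : spaceGrid h x) (i : Fin d) :
    spaceGrid h (Function.update x i (x i - h)) := by
  intro j
  by_cases hj : j = i
  · subst hj
    obtain ⟨z, hz⟩ := hx j
    exact ⟨z - 1, by rw [Function.update_self, hz]; push_cast; ring⟩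
  · rw [Function.update_of_ne hj]; exact hx j

/-- The weighted energy. -/
def Zen {d : ℕ} (V : (Fin d → ℝ) → ℝ) (W : ℕ → (Fin d → ℝ) → ℝ) : ℕ → (Fin d → ℝ) → ℝ
  | 0 => fun x => V x ^ 2 + W 0 x ^ 2
  | n + 1 => fun x => Zen V W n x + 2 ^ (n + 1) * (W (n + 1) x - V x) ^ 2

theorem Zen_nonneg {d : ℕ} (V : (Fin d → ℝ) → ℝ) (W : ℕ → (Fin d → ℝ) → ℝ) (n : ℕ)
    (x : Fin d → ℝ) : 0 ≤ Zen V W n x := by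
  induction n with
  | zero => unfold Zen; positivity
  | succ n ih => unfold Zen; positivity

theorem Zen_terminal {d : ℕ} (V : (Fin d → ℝ) → ℝ) (W : ℕ → (Fin d → ℝ) → ℝ) (n : ℕ)
    (x : Fin d → ℝ) (hx : ∀ n, W n x = V x) : Zen V W n x = 2 * V x ^ 2 := by
  induction n with
  | zero => unfold Zen; rw [hx]; ring
  | succ n ih => unfold Zen; rw [hx, ih]; ring

/-- Theorem 1.1, exponential convergence of policy iteration: under (N2),
(N4) and `ν ≤ λ`, `0 < λ ≤ Σᵢ + ν ≤ Λ`, one has for all `n ≥ 1`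
`sup_{Ω^{τ,h}_T} |Vₙ − V|² ≤ C_h 2^{−n−1}` with
`C_h = e^{C₁T/λ}(12‖g‖²_∞ + Tλ)` and `C₁ = 48 max{‖c‖²_∞, 2d‖f‖²_∞}`. -/
theorem policy_iteration_exponential_convergence
    {d m₁ m₂ : ℕ} (hd : 0 < d)
    {A : Set (Fin m₁ → ℝ)} {B : Set (Fin m₂ → ℝ)}
    (hA : IsCompact A) (hAne : A.Nonempty) (hB : IsCompact B) (hBne : B.Nonempty)
    (c : ℝ → (Fin d → ℝ) → (Fin m₁ → ℝ) → (Fin m₂ → ℝ) → ℝ)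
    (f : ℝ → (Fin d → ℝ) → (Fin m₁ → ℝ) → (Fin m₂ → ℝ) → Fin d → ℝ)
    (hc_cont : Continuous fun q : ℝ × (Fin d → ℝ) × (Fin m₁ → ℝ) × (Fin m₂ → ℝ) =>
      c q.1 q.2.1 q.2.2.1 q.2.2.2)
    (hf_cont : Continuous fun q : ℝ × (Fin d → ℝ) × (Fin m₁ → ℝ) × (Fin m₂ → ℝ) =>
      f q.1 q.2.1 q.2.2.1 q.2.2.2)
    (Mc Mf Mg : ℝ)
    (hMc : ∀ t x a b, |c t x a b| ≤ Mc)
    (hMf : ∀ t x a b, nrm (f t x a b) ≤ Mf)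
    (Sg : Fin d → ℝ → (Fin d → ℝ) → ℝ)
    (hSg_nonneg : ∀ i t x, 0 ≤ Sg i t x)
    (MS : ℝ) (hMS : ∀ i t x, Sg i t x ≤ MS)
    (g : (Fin d → ℝ) → ℝ) (hMg : ∀ x, |g x| ≤ Mg)
    (T τ h ν : ℝ) (hT : 0 < T)
    (hτ : τ ∈ Set.Ioo (0:ℝ) 1) (hh : h ∈ Set.Ioo (0:ℝ) 1)
    (hTτ : ∃ N : ℕ, T = N * τ) (hν : 0 ≤ ν)
    (hN2a : ∀ i t x a b, h * |f t x a b i| ≤ ν + Sg i t x)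
    (hN2b : ∀ t x, (d : ℝ) * ν + ∑ i, Sg i t x ≤ h ^ 2 / τ)
    (lam Lam : ℝ) (hνlam : ν ≤ lam) (hlam : 0 < lam)
    (hlow : ∀ i t x, lam ≤ Sg i t x + ν) (hupp : ∀ i t x, Sg i t x + ν ≤ Lam)
    (hN4a : ∀ i t x, (d : ℝ) * τ * Sg i t x ≤ 4 * h ^ 2)
    (hN4b : ∀ i t x, 96 * τ * max (Mc ^ 2) (2 * (d : ℝ) * Mf ^ 2) ≤ Sg i t x + ν)
    (V : ℝ → (Fin d → ℝ) → ℝ)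
    (hV_eq : ∀ t x, timeGrid τ T t → τ ≤ t → spaceGrid h x →
      dtT τ V t x + Ham A B c f t x (cgrad h (V t) x)
        = -(1/2) * ∑ i, (Sg i t x + ν) * lap1 h (V t) x i)
    (hV_T : ∀ x, spaceGrid h x → V T x = g x)
    (αn : ℕ → ℝ → (Fin d → ℝ) → (Fin m₁ → ℝ))
    (βn : ℕ → ℝ → (Fin d → ℝ) → (Fin m₂ → ℝ))
    (αnb : ℕ → (Fin m₂ → ℝ) → ℝ → (Fin d → ℝ) → (Fin m₁ → ℝ))
    (hαA : ∀ n t x, αn n t x ∈ A) (hβB : ∀ n t x, βn n t x ∈ B)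
    (hαbA : ∀ n b t x, αnb n b t x ∈ A)
    (Vn : ℕ → ℝ → (Fin d → ℝ) → ℝ)
    (hVn_eq : ∀ n t x, timeGrid τ T t → τ ≤ t → spaceGrid h x →
      dtT τ (Vn n) t x
          + Lrun c f t x (cgrad h (Vn n t) x) (αn n t x) (βn n t x)
        = -(1/2) * ∑ i, (Sg i t x + ν) * lap1 h (Vn n t) x i)
    (hVn_T : ∀ n x, spaceGrid h x → Vn n T x = g x)
    (hmin : ∀ n t x, timeGrid τ T t → spaceGrid h x → ∀ b ∈ B, ∀ a ∈ A,
      Lrun c f t x (cgrad h (Vn n t) x) (αnb (n+1) b t x) b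
        ≤ Lrun c f t x (cgrad h (Vn n t) x) a b)
    (hmax : ∀ n t x, timeGrid τ T t → spaceGrid h x → ∀ b ∈ B,
      Lrun c f t x (cgrad h (Vn n t) x) (αnb (n+1) b t x) b
        ≤ Lrun c f t x (cgrad h (Vn n t) x)
            (αnb (n+1) (βn (n+1) t x) t x) (βn (n+1) t x))
    (hsel : ∀ n t x, αn (n+1) t x = αnb (n+1) (βn (n+1) t x) t x)
    :
    ∀ n : ℕ, 1 ≤ n → ∀ t x, timeGrid τ T t → spaceGrid h x →
      (Vn n t x - V t x) ^ 2
        ≤ Real.exp (48 * max (Mc ^ 2) (2 * (d : ℝ) * Mf ^ 2) * T / lam)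
            * (12 * Mg ^ 2 + T * lam) * (2 : ℝ) ^ (-(n : ℤ) - 1) := by
  obtain ⟨hτ0, hτ1⟩ := hτ
  obtain ⟨hh0, hh1⟩ := hh
  set m := max (Mc ^ 2) (2 * (d : ℝ) * Mf ^ 2) with hm_def
  have hm : 0 ≤ m := le_max_of_le_left (sq_nonneg _)
  have hmc : Mc ^ 2 ≤ m := le_max_left _ _
  have hd1 : (1 : ℝ) ≤ d := by exact_mod_cast hd
  have hmf : 2 * Mf ^ 2 ≤ m := by
    refine le_trans ?_ (le_max_right _ _)
    nlinarith [sq_nonneg Mf]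
  have haL : ∀ t x i, max lam (96 * τ * m) ≤ Sg i t x + ν :=
    fun t x i => max_le (hlow i t x) (hN4b i t x)
  have hθ : ∀ t x i, 0 ≤ τ * (Sg i t x + ν) / h ^ 2 := by
    intro t x i
    have := hlam.le.trans (hlow i t x)
    positivity
  have hθs : ∀ t x, ∑ i, τ * (Sg i t x + ν) / h ^ 2 ≤ 1 := by
    intro t x
    rw [← Finset.sum_div, ← Finset.mul_sum, Finset.sum_add_distrib, div_le_one (by positivity)]
    have h1 := hN2b t x
    rw [le_div_iff₀ hτ0] at h1
    simp only [Finset.sum_const, Finset.card_univ, Fintype.card_fin, nsmul_eq_mul]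
    linarith
  -- explicit form of the schemes
  have hVs : ∀ t x, timeGrid τ T t → τ ≤ t → spaceGrid h x →
      V (t - τ) x = Pop τ h (fun i => Sg i t x + ν) (V t) x
        + τ * Ham A B c f t x (cgrad h (V t) x) := by
    intro t x ht htτ hx
    have h1 := hV_eq t x ht htτ hx
    unfold dtT at h1
    unfold Pop
    field_simp at h1
    linarith
  have hVns : ∀ n t x, timeGrid τ T t → τ ≤ t → spaceGrid h x →
      Vn n (t - τ) x = Pop τ h (fun i => Sg i t x + ν) (Vn n t) x
        + τ * Lrun c f t x (cgrad h (Vn n t) x) (αn n t x) (βn n t x) := by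
    intro n t x ht htτ hx
    have h1 := hVn_eq n t x ht htτ hx
    unfold dtT at h1
    unfold Pop
    field_simp at h1
    linarith
  have hHeq : ∀ n t x, timeGrid τ T t → spaceGrid h x →
      Ham A B c f t x (cgrad h (Vn n t) x)
        = Lrun c f t x (cgrad h (Vn n t) x) (αn (n+1) t x) (βn (n+1) t x) := by
    intro n t x ht hx
    rw [hsel]
    exact supinf_eq (φ := Lrun c f t x (cgrad h (Vn n t) x)) hAne hBne
      (Lrun_abs hMc hMf t x _) (fun b => αnb (n+1) b t x) (βn (n+1) t x)
      (fun b => hαbA (n+1) b t x) (hβB (n+1) t x) (hmin n t x ht hx) (hmax n t x ht hx)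
  have hgrow : ∀ (s : ℝ) (p : Fin d → ℝ), |s| ≤ Mc + Mf * nrm p →
      s ^ 2 ≤ m * (2 + ∑ i, p i ^ 2) := by
    intro s p hs
    rw [← nrm_sq]
    have h1 : s ^ 2 ≤ (Mc + Mf * nrm p) ^ 2 := by
      rw [← sq_abs s]; gcongr
    have h2 := mul_le_mul_of_nonneg_right hmf (sq_nonneg (nrm p))
    nlinarith [sq_nonneg (Mc - Mf * nrm p)]
  -- the difference step
  have hdiff : ∀ n t x, timeGrid τ T t → τ ≤ t → spaceGrid h x →
      (Vn (n+1) (t - τ) x - V (t - τ) x) ^ 2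
        ≤ (1 + τ * (48 * m / lam)) * Pop τ h (fun i => Sg i t x + ν)
            (fun y => (Vn (n+1) t y - V t y) ^ 2) x
          - τ * max lam (96 * τ * m) * (1/4)
            * ∑ i, cgrad h (fun y => Vn (n+1) t y - V t y) x i ^ 2
          + τ * max lam (96 * τ * m) * (1/8)
            * ∑ i, cgrad h (fun y => Vn n t y - V t y) x i ^ 2 := by
    intro n t x ht htτ hx
    refine step_diff (s := Lrun c f t x (cgrad h (Vn (n+1) t) x) (αn (n+1) t x) (βn (n+1) t x)
      - Ham A B c f t x (cgrad h (V t) x)) hτ0 hh0 hm hlam (fun i => Sg i t x + ν)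
      (fun y => Vn (n+1) t y - V t y) x (haL t x) (hθ t x) (hθs t x)
      (Finset.sum_nonneg (fun i _ => sq_nonneg _)) ?_ ?_
    · have hH := Ham_sub_abs hAne hBne hMc hMf t x (cgrad h (Vn n t) x) (cgrad h (V t) x)
      rw [hHeq n t x ht hx] at hH
      have hMf0 : 0 ≤ Mf := (Real.sqrt_nonneg _).trans (hMf t x (αn n t x) (βn n t x))
      set q := ∑ i, cgrad h (fun y => Vn (n+1) t y - V t y) x i ^ 2 with hq
      set q' := ∑ i, cgrad h (fun y => Vn n t y - V t y) x i ^ 2 with hq'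
      have hqn : 0 ≤ q := Finset.sum_nonneg (fun i _ => sq_nonneg _)
      have hqn' : 0 ≤ q' := Finset.sum_nonneg (fun i _ => sq_nonneg _)
      have e1 : (Lrun c f t x (cgrad h (Vn n t) x) (αn (n+1) t x) (βn (n+1) t x)
          - Ham A B c f t x (cgrad h (V t) x)) ^ 2 ≤ Mf ^ 2 * q' := by
        rw [← sq_abs]
        calc _ ≤ (Mf * nrm (fun i => cgrad h (Vn n t) x i - cgrad h (V t) x i)) ^ 2 := by gcongr
          _ = Mf ^ 2 * q' := by
            rw [mul_pow, nrm_sq, hq']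
            simp only [cgrad_sub]
      have e2 : (Lrun c f t x (cgrad h (Vn (n+1) t) x) (αn (n+1) t x) (βn (n+1) t x)
          - Lrun c f t x (cgrad h (Vn n t) x) (αn (n+1) t x) (βn (n+1) t x)) ^ 2
          ≤ Mf ^ 2 * (2 * q + 2 * q') := by
        rw [Lrun_sub]
        refine (dot_sq_le (fun i => cgrad h (Vn (n+1) t) x i - cgrad h (Vn n t) x i) _
          (hMf t x (αn (n+1) t x) (βn (n+1) t x))).trans ?_
        refine mul_le_mul_of_nonneg_left ?_ (sq_nonneg _)
        have := sum_sub_sq (cgrad h (fun y => Vn (n+1) t y - V t y) x)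
          (cgrad h (fun y => Vn n t y - V t y) x)
        refine le_trans (le_of_eq ?_) this
        refine Finset.sum_congr rfl (fun i _ => ?_)
        rw [cgrad_sub, cgrad_sub]; ring
      set X := Lrun c f t x (cgrad h (Vn (n+1) t) x) (αn (n+1) t x) (βn (n+1) t x)
      set Y := Lrun c f t x (cgrad h (Vn n t) x) (αn (n+1) t x) (βn (n+1) t x)
      set W := Ham A B c f t x (cgrad h (V t) x)
      have e3 : (X - W) ^ 2 ≤ 2 * (X - Y) ^ 2 + 2 * (Y - W) ^ 2 := by
        nlinarith [sq_nonneg (X - Y - (Y - W))]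
      have e4 := mul_le_mul_of_nonneg_right hmf hqn
      have e5 := mul_le_mul_of_nonneg_right hmf hqn'
      nlinarith [mul_nonneg hm hqn]
    · rw [hVns (n+1) t x ht htτ hx, hVs t x ht htτ hx, Pop_sub]; ring
  -- step of the energy
  have hZ : ∀ n t x, timeGrid τ T t → τ ≤ t → spaceGrid h x →
      Zen (V (t - τ)) (fun k => Vn k (t - τ)) n x
        ≤ (1 + τ * (48 * m / lam)) * Pop τ h (fun i => Sg i t x + ν)
            (Zen (V t) (fun k => Vn k t) n) x
          - 2 ^ n * (τ * max lam (96 * τ * m) * (1/4)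
            * ∑ i, cgrad h (fun y => Vn n t y - V t y) x i ^ 2)
          + τ * lam / 12 * (1 + τ * (48 * m / lam)) := by
    intro n t x ht htτ hx
    induction n with
    | zero =>
      have h1 := step_base hτ0 hh0 hm hlam (fun i => Sg i t x + ν) (V t) x (haL t x) (hθ t x)
        (hθs t x) (hgrow _ _ (supinf_abs (φ := Lrun c f t x (cgrad h (V t) x)) hAne hBne
          (Lrun_abs hMc hMf t x _))) (hVs t x ht htτ hx)
      have h2 := step_base hτ0 hh0 hm hlam (fun i => Sg i t x + ν) (Vn 0 t) x (haL t x) (hθ t x)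
        (hθs t x) (hgrow _ _ (Lrun_abs hMc hMf t x _ (αn 0 t x) (βn 0 t x)))
        (hVns 0 t x ht htτ hx)
      have h3 := sum_sub_sq (cgrad h (Vn 0 t) x) (cgrad h (V t) x)
      simp only [cgrad_sub, Zen]
      rw [Pop_add]
      have h4 : 0 ≤ τ * max lam (96 * τ * m) :=
        mul_nonneg hτ0.le (hlam.le.trans (le_max_left _ _))
      have h5 := mul_le_mul_of_nonneg_left h3 h4
      linarith
    | succ n ih =>
      have h1 := hdiff n t x ht htτ hx
      have h2 := mul_le_mul_of_nonneg_left h1 (by positivity : (0:ℝ) ≤ 2 ^ (n + 1))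
      simp only [Zen]
      rw [Pop_add, Pop_smul]
      rw [pow_succ] at h2 ⊢
      linarith
  -- backward induction in time
  obtain ⟨N, hN⟩ := hTτ
  have hK : 0 ≤ 48 * m / lam := by positivity
  have hmain : ∀ n j : ℕ, ∀ k : ℕ, k + j = N → ∀ x, spaceGrid h x →
      Zen (V (k * τ)) (fun l => Vn l (k * τ)) n x
        ≤ Real.exp (j * (τ * (48 * m / lam))) * (2 * Mg ^ 2 + j * (τ * lam / 12)) := by
    intro n j
    induction j with
    | zero =>
      intro k hk x hx
      have hkT : (k : ℝ) * τ = T := by rw [hN]; congr 2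
      rw [hkT, Zen_terminal]
      · rw [hV_T x hx]
        have : g x ^ 2 ≤ Mg ^ 2 := by
          rw [← sq_abs]; exact pow_le_pow_left₀ (abs_nonneg _) (hMg x) 2
        simp; linarith
      · intro l; rw [hV_T x hx, hVn_T l x hx]
    | succ j ih =>
      intro k hk x hx
      have ih' := ih (k + 1) (by omega)
      have hgrid : timeGrid τ T ((k + 1 : ℕ) * τ) := by
        refine ⟨⟨k + 1, rfl⟩, ?_⟩
        rw [hN]
        have : ((k + 1 : ℕ) : ℝ) ≤ N := by exact_mod_cast (by omega)
        exact mul_le_mul_of_nonneg_right this hτ0.le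
      have hle : τ ≤ ((k + 1 : ℕ) : ℝ) * τ := by
        push_cast
        have : 0 ≤ (k : ℝ) * τ := by positivity
        linarith
      have h1 := hZ n _ x hgrid hle hx
      have hk1 : ((k + 1 : ℕ) : ℝ) * τ - τ = k * τ := by push_cast; ring
      rw [hk1] at h1
      have h2 := Pop_le (fun i => Sg i ((k + 1 : ℕ) * τ) x + ν)
        (Zen (V ((k + 1 : ℕ) * τ)) (fun l => Vn l ((k + 1 : ℕ) * τ)) n) x
        (hθ _ x) (hθs _ x) _ (ih' x hx) (fun i => ih' _ (spaceGrid_add hx i))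
        (fun i => ih' _ (spaceGrid_sub hx i))
      have h3 : 0 ≤ (2:ℝ) ^ n * (τ * max lam (96 * τ * m) * (1/4)
            * ∑ i, cgrad h (fun y => Vn n ((k + 1 : ℕ) * τ) y - V ((k + 1 : ℕ) * τ) y) x i ^ 2) := by
        have h4 : 0 ≤ max lam (96 * τ * m) := hlam.le.trans (le_max_left _ _)
        have h5 : 0 ≤ ∑ i, cgrad h
          (fun y => Vn n ((k + 1 : ℕ) * τ) y - V ((k + 1 : ℕ) * τ) y) x i ^ 2 :=
          Finset.sum_nonneg (fun i _ => sq_nonneg _)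
        positivity
      set y := τ * (48 * m / lam) with hy
      have hy0 : 0 ≤ y := by positivity
      have h6 : 1 + y ≤ Real.exp y := by linarith [Real.add_one_le_exp y]
      have h7 : (1:ℝ) ≤ Real.exp (j * y) := Real.one_le_exp (by positivity)
      have h8 : Real.exp ((j + 1 : ℕ) * y) = Real.exp y * Real.exp (j * y) := by
        rw [← Real.exp_add]; congr 1; push_cast; ring
      rw [h8]
      have h9 : 0 ≤ τ * lam / 12 := by positivity
      have h10 := mul_le_mul_of_nonneg_left h2 (by linarith : 0 ≤ 1 + y)
      calc _ ≤ (1 + y) * (Real.exp (j * y) * (2 * Mg ^ 2 + j * (τ * lam / 12)))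
            + τ * lam / 12 * (1 + y) := by linarith
        _ = (1 + y) * (Real.exp (j * y) * (2 * Mg ^ 2 + j * (τ * lam / 12)) + 1 * (τ * lam / 12)) := by
            ring
        _ ≤ Real.exp y * (Real.exp (j * y) * (2 * Mg ^ 2 + j * (τ * lam / 12))
            + Real.exp (j * y) * (τ * lam / 12)) := by gcongr
        _ = _ := by push_cast; ring
  intro n hn t x ht hx
  obtain ⟨⟨k, rfl⟩, htT⟩ := ht
  have hkN : k ≤ N := by
    rw [hN] at htT
    exact_mod_cast le_of_mul_le_mul_right htT hτ0
  have h1 := hmain n (N - k) k (by omega) x hx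
  obtain ⟨n, rfl⟩ : ∃ l, n = l + 1 := ⟨n - 1, by omega⟩
  have h2 := Zen_nonneg (V (k * τ)) (fun l => Vn l (k * τ)) n x
  simp only [Zen] at h1
  have hjN : ((N - k : ℕ) : ℝ) * τ ≤ T := by
    rw [hN]
    exact mul_le_mul_of_nonneg_right (by exact_mod_cast Nat.sub_le N k) hτ0.le
  have h3 : Real.exp ((N - k : ℕ) * (τ * (48 * m / lam))) * (2 * Mg ^ 2 + (N - k : ℕ) * (τ * lam / 12))
      ≤ Real.exp (48 * m * T / lam) * ((12 * Mg ^ 2 + T * lam) / 2) := by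
    have e1 : ((N - k : ℕ) : ℝ) * (τ * (48 * m / lam)) ≤ 48 * m * T / lam := by
      have := mul_le_mul_of_nonneg_right hjN hK
      calc _ = ((N - k : ℕ) : ℝ) * τ * (48 * m / lam) := by ring
        _ ≤ _ := this
        _ = _ := by ring
    have e2 : 2 * Mg ^ 2 + ((N - k : ℕ) : ℝ) * (τ * lam / 12) ≤ (12 * Mg ^ 2 + T * lam) / 2 := by
      have := mul_le_mul_of_nonneg_right hjN hlam.le
      nlinarith [sq_nonneg Mg, mul_pos hT hlam]
    exact mul_le_mul (Real.exp_le_exp.2 e1) e2 (by positivity) (Real.exp_pos _).le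
  have h4 : (2:ℝ) ^ (-((n + 1 : ℕ) : ℤ) - 1) = 1 / (2 ^ (n + 1) * 2) := by
    have : -((n + 1 : ℕ) : ℤ) - 1 = -((n + 2 : ℕ) : ℤ) := by push_cast; ring
    rw [this, zpow_neg, zpow_natCast, one_div]
    congr 1
  rw [h4, mul_one_div, le_div_iff₀ (by positivity)]
  linarith
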